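/- Let θ ∈ ℝ be an angle that is not an integer multiple of π/2. Let Rx, Ry, Rz denote the 3×3 rotation matrices by angle θ about the x, y, and z coordinate axes respectively. Then the subgroup of SO(3) generated by Rx, Ry, Rz is dense in SO(3). -/

import Mathlib

open Matrix

/-- The matrix of the cross product with `v`. -/
def crossMatrix (v : Fin 3 → ℝ) : Matrix (Fin 3) (Fin 3) ℝ :=
  !![0, -v 2, v 1; v 2, 0, -v 0; -v 1, v 0, 0]

/-- The rotation by the angle `t` about the unit vector `v` (Rodrigues' formula). -/
noncomputable def axisRotation (v : Fin 3 → ℝ) (t : ℝ) : Matrix (Fin 3) (Fin 3) ℝ :=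
  1 + Real.sin t • crossMatrix v + (1 - Real.cos t) • (crossMatrix v * crossMatrix v)

theorem crossMatrix_transpose (v : Fin 3 → ℝ) : (crossMatrix v)ᵀ = -crossMatrix v := by
  ext i j
  fin_cases i <;> fin_cases j <;> simp [crossMatrix]

theorem crossMatrix_pow_three {v : Fin 3 → ℝ} (hv : v ⬝ᵥ v = 1) :
    crossMatrix v * (crossMatrix v * crossMatrix v) = -crossMatrix v := by
  simp only [dotProduct, Fin.sum_univ_three] at hv
  ext i j
  fin_cases i <;> fin_cases j <;> simp [crossMatrix, Matrix.mul_apply, Fin.sum_univ_three] <;>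
    grind

theorem axisRotation_add {v : Fin 3 → ℝ} (hv : v ⬝ᵥ v = 1) (s t : ℝ) :
    axisRotation v (s + t) = axisRotation v s * axisRotation v t := by
  have h3 := crossMatrix_pow_three hv
  have h4 : crossMatrix v * crossMatrix v * (crossMatrix v * crossMatrix v) =
      -(crossMatrix v * crossMatrix v) := by
    rw [Matrix.mul_assoc, h3, Matrix.mul_neg]
  simp only [axisRotation, Real.sin_add, Real.cos_add, Matrix.add_mul, Matrix.mul_add,
    Matrix.smul_mul, Matrix.mul_smul, Matrix.one_mul, Matrix.mul_one, h3, h4, Matrix.mul_assoc]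
  module

theorem axisRotation_transpose (v : Fin 3 → ℝ) (t : ℝ) :
    (axisRotation v t)ᵀ = axisRotation v (-t) := by
  simp [axisRotation, crossMatrix_transpose]

theorem axisRotation_zero (v : Fin 3 → ℝ) : axisRotation v 0 = 1 := by
  simp [axisRotation]

theorem axisRotation_mem_orthogonalGroup {v : Fin 3 → ℝ} (hv : v ⬝ᵥ v = 1) (t : ℝ) :
    axisRotation v t ∈ orthogonalGroup (Fin 3) ℝ := by
  rw [mem_orthogonalGroup_iff, axisRotation_transpose, ← axisRotation_add hv, add_neg_cancel,
    axisRotation_zero]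

theorem adjugate_eq_transpose {n R : Type*} [Fintype n] [DecidableEq n] [CommRing R]
    {A : Matrix n n R} (hA : Aᵀ * A = 1) (hdet : A.det = 1) : A.adjugate = Aᵀ := by
  calc A.adjugate = Aᵀ * A * A.adjugate := by rw [hA, Matrix.one_mul]
    _ = Aᵀ := by rw [Matrix.mul_assoc, Matrix.mul_adjugate, hdet, one_smul, Matrix.mul_one]

theorem mul_crossMatrix_mul_transpose {A : Matrix (Fin 3) (Fin 3) ℝ} (hA : Aᵀ * A = 1)
    (hdet : A.det = 1) (v : Fin 3 → ℝ) : A * crossMatrix v * Aᵀ = crossMatrix (A *ᵥ v) := by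
  have key : A * crossMatrix v * Aᵀ = crossMatrix (A.adjugateᵀ *ᵥ v) := by
    ext i j
    fin_cases i <;> fin_cases j <;>
      simp [crossMatrix, Matrix.mul_apply, Fin.sum_univ_three, Matrix.adjugate_fin_three,
        Matrix.mulVec, dotProduct] <;> ring
  rw [key, adjugate_eq_transpose hA hdet, transpose_transpose]

theorem mul_axisRotation_mul_transpose {A : Matrix (Fin 3) (Fin 3) ℝ} (hA : Aᵀ * A = 1)
    (hdet : A.det = 1) (v : Fin 3 → ℝ) (t : ℝ) :
    A * axisRotation v t * Aᵀ = axisRotation (A *ᵥ v) t := by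
  have hA' : A * Aᵀ = 1 := mul_eq_one_comm.mp hA
  simp only [axisRotation, ← mul_crossMatrix_mul_transpose hA hdet, Matrix.add_mul, Matrix.mul_add,
    Matrix.smul_mul, Matrix.mul_smul, Matrix.mul_one, hA']
  congr 2
  calc A * (crossMatrix v * crossMatrix v) * Aᵀ
      = A * crossMatrix v * 1 * crossMatrix v * Aᵀ := by simp only [Matrix.mul_assoc, Matrix.one_mul]
    _ = _ := by rw [← hA]; simp only [Matrix.mul_assoc]

theorem continuous_axisRotation (v : Fin 3 → ℝ) : Continuous (axisRotation v) := by
  unfold axisRotation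
  fun_prop

theorem isCompact_orthogonalGroup (n : Type*) [Fintype n] [DecidableEq n] :
    IsCompact (orthogonalGroup n ℝ : Set (Matrix n n ℝ)) := by
  have hK : IsCompact ((Set.univ.pi fun _ => Set.univ.pi fun _ => Set.Icc (-1 : ℝ) 1) :
      Set (Matrix n n ℝ)) :=
    isCompact_univ_pi fun _ => isCompact_univ_pi fun _ => isCompact_Icc
  refine hK.of_isClosed_subset (isClosed_unitary (R := Matrix n n ℝ)) fun A hA i _ j _ => ?_
  exact abs_le.mp (entry_norm_bound_of_unitary hA i j)

theorem exists_exp_mul_I_pow_eq_one {θ : ℝ} (hθ : ¬ Irrational (θ / (2 * Real.pi))) :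
    ∃ n : ℕ, 0 < n ∧ Complex.exp (θ * Complex.I) ^ n = 1 := by
  rw [Irrational, not_not] at hθ
  obtain ⟨q, hq⟩ := hθ
  refine ⟨q.den, q.pos, ?_⟩
  rw [← Complex.exp_nat_mul, Complex.exp_eq_one_iff]
  refine ⟨q.num, ?_⟩
  have h1 : θ = q * (2 * Real.pi) := by rw [hq]; field_simp
  have h2 : (q.den : ℝ) * q = q.num := by exact_mod_cast Rat.den_mul_eq_num q
  have : (q.den : ℝ) * θ = q.num * (2 * Real.pi) := by rw [h1, ← h2]; ring
  have h3 : (q.den : ℂ) * θ = q.num * (2 * Real.pi) := by exact_mod_cast this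
  linear_combination Complex.I * h3

theorem isIntegral_two_mul_cos {θ : ℝ} {n : ℕ} (hn : 0 < n)
    (h : Complex.exp (θ * Complex.I) ^ n = 1) : IsIntegral ℤ (2 * Complex.cos θ) := by
  rw [Complex.two_cos]
  refine .add (.of_pow hn (by rw [h]; exact isIntegral_one)) (.of_pow hn ?_)
  rw [neg_mul, Complex.exp_neg, inv_pow, h, inv_one]
  exact isIntegral_one

/-- By Kronecker's theorem, a cosine of a rational angle is an algebraic integer only if it is `0` or
`±1`. -/
theorem sin_two_mul_eq_zero_of_isIntegral_cos {θ : ℝ} {n : ℕ} (hn : 0 < n)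
    (h : Complex.exp (θ * Complex.I) ^ n = 1) (hc : IsIntegral ℤ (Complex.cos θ)) :
    Real.sin (2 * θ) = 0 := by
  rw [Real.sin_two_mul]
  by_cases h0 : Real.cos θ = 0
  · simp [h0]
  set ζ := Complex.exp (θ * Complex.I) with hζ
  have hint : IsIntegral ℚ ζ := .of_pow hn (by rw [h]; exact isIntegral_one)
  let K := IntermediateField.adjoin ℚ {ζ}
  have : FiniteDimensional ℚ K := IntermediateField.adjoin.finiteDimensional hint
  have : NumberField K := ⟨⟩
  let z : K := ⟨ζ, IntermediateField.mem_adjoin_simple_self ℚ ζ⟩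
  have hz : z ^ n = 1 := Subtype.ext h
  let x : K := (z + z⁻¹) / 2
  have hx : (x : ℂ) = Complex.cos θ := by
    simp only [x, z, Complex.cos, hζ, neg_mul, Complex.exp_neg]
    push_cast
    rfl
  have hx0 : x ≠ 0 := by
    intro hx0
    rw [hx0] at hx
    apply h0
    have : ((0 : ℂ)) = (Real.cos θ : ℂ) := by simpa using hx
    exact_mod_cast this.symm
  have hxi : IsIntegral ℤ x := by
    rw [← isIntegral_algebraMap_iff (B := ℂ) (algebraMap K ℂ).injective]
    change IsIntegral ℤ (x : ℂ)
    rwa [hx]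
  obtain ⟨m, hm, hxm⟩ := NumberField.Embeddings.pow_eq_one_of_norm_le_one (x := x) K ℂ hx0 hxi
    fun φ => by
      have h1 : ‖φ z‖ = 1 := by
        refine Complex.norm_eq_one_of_pow_eq_one (n := n) ?_ hn.ne'
        rw [← map_pow, hz, map_one]
      have : φ x = (φ z + (φ z)⁻¹) / 2 := by simp [x, map_ofNat]
      rw [this, norm_div]
      have := norm_add_le (φ z) (φ z)⁻¹
      rw [norm_inv, h1] at this
      norm_num at this ⊢
      linarith
  have hcm : Real.cos θ ^ m = 1 := by
    have : (x : ℂ) ^ m = 1 := by exact_mod_cast congrArg (Subtype.val) hxm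
    rw [hx] at this
    exact_mod_cast this
  have habs : |Real.cos θ| = 1 := by
    rw [← pow_eq_one_iff_of_nonneg (abs_nonneg _) hm.ne', ← abs_pow, hcm, abs_one]
  have h1 : Real.cos θ ^ 2 = 1 := by rw [← sq_abs, habs, one_pow]
  have h2 : Real.sin θ = 0 := by
    have := Real.sin_sq_add_cos_sq θ
    exact pow_eq_zero_iff two_ne_zero |>.mp (by linarith)
  simp [h2]

/-- If both angles were commensurable with `π`, then `2 * cos θ` and `2 * cos φ`, hence `cos θ`, would
be algebraic integers. -/
theorem irrational_or_irrational {θ φ : ℝ} (hθ : Real.sin (2 * θ) ≠ 0)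
    (h : 1 + 2 * Real.cos φ = Real.cos θ ^ 2 + 2 * Real.cos θ) :
    Irrational (θ / (2 * Real.pi)) ∨ Irrational (φ / (2 * Real.pi)) := by
  by_contra! hcon
  obtain ⟨n, hn, hn1⟩ := exists_exp_mul_I_pow_eq_one hcon.1
  obtain ⟨m, hm, hm1⟩ := exists_exp_mul_I_pow_eq_one hcon.2
  refine hθ (sin_two_mul_eq_zero_of_isIntegral_cos hn hn1 (.of_pow two_pos ?_))
  have h' : Complex.cos θ ^ 2 = 1 + 2 * Complex.cos φ - 2 * Complex.cos θ := by
    have : Real.cos θ ^ 2 = 1 + 2 * Real.cos φ - 2 * Real.cos θ := by linarith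
    exact_mod_cast congrArg Complex.ofReal this
  rw [h']
  exact (isIntegral_one.add (isIntegral_two_mul_cos hm hm1)).sub (isIntegral_two_mul_cos hn hn1)

/-- A closed subgroup of `O(3)` containing a rotation of infinite order contains all rotations about
the same axis. -/
theorem axisRotation_mem_of_irrational {H : Subgroup (orthogonalGroup (Fin 3) ℝ)}
    (hH : IsClosed (H : Set (orthogonalGroup (Fin 3) ℝ))) {v : Fin 3 → ℝ} (hv : v ⬝ᵥ v = 1)
    {φ : ℝ} (hφ : Irrational (φ / (2 * Real.pi)))
    (hmem : (⟨axisRotation v φ, axisRotation_mem_orthogonalGroup hv φ⟩ : orthogonalGroup (Fin 3) ℝ)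
      ∈ H) (t : ℝ) :
    (⟨axisRotation v t, axisRotation_mem_orthogonalGroup hv t⟩ : orthogonalGroup (Fin 3) ℝ)
      ∈ H := by
  let f : Multiplicative ℝ →* orthogonalGroup (Fin 3) ℝ :=
    { toFun := fun t => ⟨axisRotation v t.toAdd, axisRotation_mem_orthogonalGroup hv _⟩
      map_one' := Subtype.ext (axisRotation_zero v)
      map_mul' := fun s t => Subtype.ext (axisRotation_add hv _ _) }
  let S : AddSubgroup ℝ := (H.comap f).toAddSubgroup'
  have hS : IsClosed (S : Set ℝ) := hH.preimage ((continuous_axisRotation v).subtype_mk _)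
  have hdense := dense_addSubgroupClosure_pair_iff.mpr hφ
  have hle : AddSubgroup.closure {φ, 2 * Real.pi} ≤ S := by
    rw [AddSubgroup.closure_le, Set.pair_subset_iff]
    refine ⟨hmem, ?_⟩
    have : axisRotation v (2 * Real.pi) = 1 := by simp [axisRotation]
    change (⟨axisRotation v (2 * Real.pi), _⟩ : orthogonalGroup (Fin 3) ℝ) ∈ H
    exact (Subtype.ext this : (⟨axisRotation v (2 * Real.pi), axisRotation_mem_orthogonalGroup hv _⟩ :
      orthogonalGroup (Fin 3) ℝ) = 1) ▸ H.one_mem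
  exact hS.closure_subset_iff.mpr hle (hdense t)

theorem eq_zero_and_nonpos_of_forall_sin_cos {a b : ℝ}
    (h : ∀ t : ℝ, Real.sin t * a + (1 - Real.cos t) * b ≤ 0) : a = 0 ∧ b ≤ 0 := by
  constructor
  · have hd : HasDerivAt (fun t : ℝ => Real.sin t * a + (1 - Real.cos t) * b) a 0 := by
      have := ((Real.hasDerivAt_sin 0).mul_const a).add
        (((Real.hasDerivAt_cos 0).const_sub 1).mul_const b)
      exact this.congr_deriv (by simp)
    refine IsLocalMax.hasDerivAt_eq_zero (Filter.Eventually.of_forall fun t => ?_) hd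
    simpa using h t
  · have := h Real.pi
    simp only [Real.sin_pi, Real.cos_pi] at this
    linarith

theorem trace_crossMatrix_mul (w : Fin 3 → ℝ) (B : Matrix (Fin 3) (Fin 3) ℝ) :
    (crossMatrix w * B).trace = w ⬝ᵥ ![B 1 2 - B 2 1, B 2 0 - B 0 2, B 0 1 - B 1 0] := by
  simp only [Matrix.trace_fin_three, Matrix.mul_apply, Fin.sum_univ_three]
  simp [crossMatrix, dotProduct, Fin.sum_univ_three]
  ring

theorem trace_crossMatrix_mul_crossMatrix_mul (w : Fin 3 → ℝ) (B : Matrix (Fin 3) (Fin 3) ℝ) :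
    (crossMatrix w * crossMatrix w * B).trace = w ⬝ᵥ (B *ᵥ w) - (w ⬝ᵥ w) * B.trace := by
  simp only [Matrix.trace_fin_three, Matrix.mul_apply, Fin.sum_univ_three]
  simp [crossMatrix, dotProduct, mulVec, Fin.sum_univ_three]
  ring

/-- A symmetric rotation of `ℝ³` is the identity or a half-turn. -/
theorem eq_one_or_trace_eq_neg_one {B : Matrix (Fin 3) (Fin 3) ℝ} (hB : Bᵀ * B = 1)
    (hdet : B.det = 1) (hsymm : Bᵀ = B) : B = 1 ∨ B.trace = -1 := by
  have hadj := adjugate_eq_transpose hB hdet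
  rw [adjugate_fin_three] at hadj
  have e01 : B 1 0 = B 0 1 := congrFun (congrFun hsymm 0) 1
  have e02 : B 2 0 = B 0 2 := congrFun (congrFun hsymm 0) 2
  have e12 : B 2 1 = B 1 2 := congrFun (congrFun hsymm 1) 2
  have a0 := congrFun (congrFun hadj 0) 0
  have a1 := congrFun (congrFun hadj 1) 1
  have a2 := congrFun (congrFun hadj 2) 2
  have b0 := congrFun (congrFun hB 0) 0
  have b1 := congrFun (congrFun hB 1) 1
  have b2 := congrFun (congrFun hB 2) 2
  simp [e01, e02, e12, Matrix.mul_apply, Fin.sum_univ_three] at a0 a1 a2 b0 b1 b2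
  have hquad : (B.trace - 3) * (B.trace + 1) = 0 := by
    rw [Matrix.trace_fin_three]
    linear_combination b0 + b1 + b2 + 2 * a0 + 2 * a1 + 2 * a2
  rcases mul_eq_zero.mp hquad with h | h
  · left
    have h0 : ((B - 1)ᴴ * (B - 1)).trace = 0 := by
      rw [conjTranspose_eq_transpose_of_trivial, transpose_sub, transpose_one, hsymm]
      rw [hsymm] at hB
      simp only [Matrix.sub_mul, Matrix.mul_sub, hB, Matrix.one_mul, Matrix.mul_one,
        Matrix.trace_sub, Matrix.trace_one, Fintype.card_fin]
      push_cast
      linarith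
    exact sub_eq_zero.mp (trace_conjTranspose_mul_self_eq_zero_iff.mp h0)
  · right
    linarith

theorem mulVec_dotProduct_mulVec_self {A : Matrix (Fin 3) (Fin 3) ℝ} (hA : Aᵀ * A = 1)
    (v : Fin 3 → ℝ) : (A *ᵥ v) ⬝ᵥ (A *ᵥ v) = v ⬝ᵥ v := by
  rw [dotProduct_mulVec, ← mulVec_transpose, mulVec_mulVec, hA, one_mulVec]

theorem transpose_mul_self_coe (A : orthogonalGroup (Fin 3) ℝ) :
    (A : Matrix (Fin 3) (Fin 3) ℝ)ᵀ * A = 1 :=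
  (mem_orthogonalGroup_iff' (Fin 3) ℝ).mp A.2

theorem coe_inv_eq_transpose (A : orthogonalGroup (Fin 3) ℝ) :
    ((A⁻¹ : orthogonalGroup (Fin 3) ℝ) : Matrix (Fin 3) (Fin 3) ℝ) =
      (A : Matrix (Fin 3) (Fin 3) ℝ)ᵀ := rfl

/-- A closed group of rotations that contains all rotations about an axis `v`, and moves `v` out of
every plane, contains every rotation `A`: maximize the trace of `h * A` over `h` in the group. -/
theorem mem_of_axisRotation_mem {H : Subgroup (orthogonalGroup (Fin 3) ℝ)}
    (hH : IsClosed (H : Set (orthogonalGroup (Fin 3) ℝ)))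
    (hdet : ∀ g ∈ H, (g : Matrix (Fin 3) (Fin 3) ℝ).det = 1)
    {v : Fin 3 → ℝ} (hv : v ⬝ᵥ v = 1)
    (hrot : ∀ t, (⟨axisRotation v t, axisRotation_mem_orthogonalGroup hv t⟩ :
      orthogonalGroup (Fin 3) ℝ) ∈ H)
    (hspan : ∀ z : Fin 3 → ℝ,
      (∀ g ∈ H, ((g : Matrix (Fin 3) (Fin 3) ℝ) *ᵥ v) ⬝ᵥ z = 0) → z = 0)
    (A : orthogonalGroup (Fin 3) ℝ) (hA : (A : Matrix (Fin 3) (Fin 3) ℝ).det = 1) : A ∈ H := by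
  have : CompactSpace (orthogonalGroup (Fin 3) ℝ) :=
    isCompact_iff_compactSpace.mp (isCompact_orthogonalGroup (Fin 3))
  obtain ⟨h, hh, hmax⟩ := hH.isCompact.exists_isMaxOn ⟨1, H.one_mem⟩
    (f := fun g : orthogonalGroup (Fin 3) ℝ => ((g * A : orthogonalGroup (Fin 3) ℝ) :
      Matrix (Fin 3) (Fin 3) ℝ).trace) (by
        refine Continuous.continuousOn ?_
        exact (continuous_subtype_val.comp (continuous_mul_const A)).matrix_trace)
  set B : Matrix (Fin 3) (Fin 3) ℝ := ((h * A : orthogonalGroup (Fin 3) ℝ) :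
    Matrix (Fin 3) (Fin 3) ℝ) with hBdef
  have hB : Bᵀ * B = 1 := transpose_mul_self_coe (h * A)
  have hBdet : B.det = 1 := by
    rw [hBdef, Submonoid.coe_mul, Matrix.det_mul, hdet h hh, hA, one_mul]
  have hcrit : ∀ g ∈ H, ((g : Matrix (Fin 3) (Fin 3) ℝ) *ᵥ v) ⬝ᵥ
        ![B 1 2 - B 2 1, B 2 0 - B 0 2, B 0 1 - B 1 0] = 0 ∧
      ((g : Matrix (Fin 3) (Fin 3) ℝ) *ᵥ v) ⬝ᵥ
        (B *ᵥ ((g : Matrix (Fin 3) (Fin 3) ℝ) *ᵥ v)) ≤ B.trace := by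
    intro g hg
    have hw := mulVec_dotProduct_mulVec_self (transpose_mul_self_coe g) v
    rw [hv] at hw
    set w := (g : Matrix (Fin 3) (Fin 3) ℝ) *ᵥ v with hwdef
    rw [← trace_crossMatrix_mul, ← sub_nonpos, ← one_mul B.trace, ← hw,
      ← trace_crossMatrix_mul_crossMatrix_mul]
    refine eq_zero_and_nonpos_of_forall_sin_cos fun t => ?_
    have hmem := H.mul_mem (H.mul_mem (H.mul_mem hg (hrot t)) (H.inv_mem hg)) hh
    have hle := hmax hmem
    simp only [Set.mem_ofPred_eq] at hle
    rw [mul_assoc, Submonoid.coe_mul, ← hBdef, Submonoid.coe_mul, Submonoid.coe_mul,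
      coe_inv_eq_transpose, mul_axisRotation_mul_transpose (transpose_mul_self_coe g) (hdet g hg),
      ← hwdef, axisRotation] at hle
    simp only [Matrix.add_mul, Matrix.smul_mul, Matrix.one_mul, Matrix.trace_add,
      Matrix.trace_smul, smul_eq_mul] at hle
    linarith
  have hz := hspan _ fun g hg => (hcrit g hg).1
  have hsymm : Bᵀ = B := by
    have z0 := congrFun hz 0
    have z1 := congrFun hz 1
    have z2 := congrFun hz 2
    simp at z0 z1 z2
    ext i j
    fin_cases i <;> fin_cases j <;> simp <;> linarith
  rcases eq_one_or_trace_eq_neg_one hB hBdet hsymm with h1 | h1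
  · have : h * A = 1 := Subtype.ext h1
    rw [eq_inv_of_mul_eq_one_right this]
    exact H.inv_mem hh
  · have hrow : ∀ i, B i + (1 : Matrix (Fin 3) (Fin 3) ℝ) i = 0 := by
      intro i
      refine hspan _ fun g hg => ?_
      have hw := mulVec_dotProduct_mulVec_self (transpose_mul_self_coe g) v
      have hle := (hcrit g hg).2
      set w := (g : Matrix (Fin 3) (Fin 3) ℝ) *ᵥ v
      have hBw := mulVec_dotProduct_mulVec_self hB w
      have h0 : (B *ᵥ w + w) ⬝ᵥ (B *ᵥ w + w) = 0 := by
        refine le_antisymm ?_ (Finset.sum_nonneg fun _ _ => mul_self_nonneg _)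
        rw [add_dotProduct, dotProduct_add, dotProduct_add, dotProduct_comm (B *ᵥ w) w]
        linarith
      have h2 : (B + 1) *ᵥ w = 0 := by
        rw [add_mulVec, one_mulVec, dotProduct_self_eq_zero.mp h0]
      rw [dotProduct_comm]
      exact congrFun h2 i
    have h00 := congrFun (hrow 0) 0
    have h11 := congrFun (hrow 1) 1
    have h22 := congrFun (hrow 2) 2
    simp at h00 h11 h22
    rw [Matrix.trace_fin_three] at h1
    linarith

theorem exists_cos_eq_sin_eq {a b : ℝ} (h : a ^ 2 + b ^ 2 = 1) :
    ∃ t : ℝ, Real.cos t = a ∧ Real.sin t = b := by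
  have hn : ‖(⟨a, b⟩ : ℂ)‖ = 1 := by
    rw [← sq_eq_sq₀ (norm_nonneg _) zero_le_one, Complex.sq_norm, Complex.normSq_mk]
    linarith
  refine ⟨Complex.arg ⟨a, b⟩, ?_, ?_⟩
  · rw [Complex.cos_arg (norm_ne_zero_iff.mp (by rw [hn]; exact one_ne_zero)), hn, div_one]
  · rw [Complex.sin_arg, hn, div_one]

theorem exists_axisRotation_eq_mul (θ : ℝ) : ∃ (v : Fin 3 → ℝ) (φ : ℝ), v ⬝ᵥ v = 1 ∧
    axisRotation v φ = !![1, 0, 0; 0, Real.cos θ, -Real.sin θ; 0, Real.sin θ, Real.cos θ] *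
      !![Real.cos θ, 0, Real.sin θ; 0, 1, 0; -Real.sin θ, 0, Real.cos θ] := by
  obtain ⟨τ, rfl⟩ : ∃ τ, θ = 2 * τ := ⟨θ / 2, by ring⟩
  have hxy := Real.sin_sq_add_cos_sq τ
  rw [Real.cos_two_mul, Real.sin_two_mul]
  set x := Real.cos τ
  set y := Real.sin τ
  have hN0 : 0 < 1 + x ^ 2 := by positivity
  obtain ⟨N, hN, hN2⟩ : ∃ N : ℝ, N ≠ 0 ∧ N ^ 2 = 1 + x ^ 2 :=
    ⟨√(1 + x ^ 2), (Real.sqrt_pos.mpr hN0).ne', Real.sq_sqrt hN0.le⟩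
  have hy : y ^ 2 = 1 - x ^ 2 := by linarith
  obtain ⟨α, hcos, hsin⟩ := exists_cos_eq_sin_eq (a := x ^ 2) (b := y * N) (by
    rw [mul_pow, hN2, hy]; ring)
  have hsin2 : Real.sin (2 * α) = 2 * x ^ 2 * y * N := by
    rw [Real.sin_two_mul, hcos, hsin]; ring
  have hcos2 : 1 - Real.cos (2 * α) = 2 * y ^ 2 * N ^ 2 := by
    rw [Real.cos_two_mul, hcos, hN2, hy]; ring
  refine ⟨![x / N, x / N, y / N], 2 * α, ?_, ?_⟩
  · simp [dotProduct, Fin.sum_univ_three]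
    field_simp
    rw [hN2]
    linarith
  · rw [axisRotation, hsin2, hcos2]
    ext i j
    fin_cases i <;> fin_cases j <;>
      simp [crossMatrix, Matrix.mul_apply, Fin.sum_univ_three] <;> field_simp <;> grind

/-- The axis rotations by `θ` have no common proper nonzero invariant subspace. -/
theorem eq_top_of_mem_of_invariant {θ : ℝ} (hθ : Real.sin θ ≠ 0) (Z : Submodule ℝ (Fin 3 → ℝ))
    {X Y W : Matrix (Fin 3) (Fin 3) ℝ}
    (hX : X = !![1, 0, 0; 0, Real.cos θ, -Real.sin θ; 0, Real.sin θ, Real.cos θ])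
    (hY : Y = !![Real.cos θ, 0, Real.sin θ; 0, 1, 0; -Real.sin θ, 0, Real.cos θ])
    (hW : W = !![Real.cos θ, -Real.sin θ, 0; Real.sin θ, Real.cos θ, 0; 0, 0, 1])
    (hinv : ∀ A ∈ ({X, Y, W} : Set (Matrix (Fin 3) (Fin 3) ℝ)), ∀ z ∈ Z,
      A *ᵥ z ∈ Z ∧ Aᵀ *ᵥ z ∈ Z)
    {z : Fin 3 → ℝ} (hz : z ∈ Z) (hz0 : z ≠ 0) : Z = ⊤ := by
  have hX' := hinv X (by simp)
  have hY' := hinv Y (by simp)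
  have hW' := hinv W (by simp)
  have hc : 2 * (1 - Real.cos θ) ≠ 0 := by
    intro h
    have := Real.sin_sq_add_cos_sq θ
    have h1 : Real.cos θ = 1 := by linarith
    rw [h1] at this
    exact hθ (pow_eq_zero_iff two_ne_zero |>.mp (by linarith))
  have hsolve : ∀ {a : ℝ} {u v : Fin 3 → ℝ}, a ≠ 0 → v ∈ Z → v = a • u → u ∈ Z :=
    fun ha hv h => (Z.smul_mem_iff ha).mp (h ▸ hv)
  have h01 : ![1, 0, 0] ∈ Z → ![0, 1, 0] ∈ Z := fun h =>
    hsolve hθ (Z.sub_mem (hW' _ h).1 (Z.smul_mem (Real.cos θ) h)) (by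
      ext i; fin_cases i <;> simp [hW])
  have h12 : ![0, 1, 0] ∈ Z → ![0, 0, 1] ∈ Z := fun h =>
    hsolve hθ (Z.sub_mem (hX' _ h).1 (Z.smul_mem (Real.cos θ) h)) (by
      ext i; fin_cases i <;> simp [hX])
  have h20 : ![0, 0, 1] ∈ Z → ![1, 0, 0] ∈ Z := fun h =>
    hsolve hθ (Z.sub_mem (hY' _ h).1 (Z.smul_mem (Real.cos θ) h)) (by
      ext i; fin_cases i <;> simp [hY])
  have h0 : ![1, 0, 0] ∈ Z := by
    obtain ⟨i, hi⟩ := Function.ne_iff.mp hz0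
    have hproj : ∀ A : Matrix (Fin 3) (Fin 3) ℝ, (∀ z ∈ Z, A *ᵥ z ∈ Z ∧ Aᵀ *ᵥ z ∈ Z) →
        A *ᵥ z + Aᵀ *ᵥ z - (2 * Real.cos θ) • z ∈ Z := fun A hA =>
      Z.sub_mem (Z.add_mem (hA z hz).1 (hA z hz).2) (Z.smul_mem _ hz)
    fin_cases i
    · refine hsolve (mul_ne_zero hc hi) (hproj X hX') ?_
      ext i
      fin_cases i <;> simp [hX, mulVec_transpose, vecHead, vecTail] <;> ring
    · refine h20 (h12 (hsolve (mul_ne_zero hc hi) (hproj Y hY') ?_))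
      ext i
      fin_cases i <;> simp [hY, mulVec_transpose, vecHead, vecTail] <;> ring
    · refine h20 (hsolve (mul_ne_zero hc hi) (hproj W hW') ?_)
      ext i
      fin_cases i <;> simp [hW, mulVec_transpose, vecHead, vecTail] <;> ring
  rw [eq_top_iff]
  intro u _
  have : u = u 0 • ![1, 0, 0] + u 1 • ![0, 1, 0] + u 2 • ![0, 0, 1] := by
    ext i
    fin_cases i <;> simp
  rw [this]
  exact Z.add_mem (Z.add_mem (Z.smul_mem _ h0) (Z.smul_mem _ (h01 h0)))
    (Z.smul_mem _ (h12 (h01 h0)))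

open Real in
/-- If `θ` is not an integer multiple of `π/2`, then the rotations by `θ`
about the three coordinate axes generate a dense subgroup of `SO(3)`: the closure (inside
`O(3)`) of the subgroup they generate is exactly the set of orthogonal matrices of
determinant `1`. -/
theorem rotations_dense_in_SO3 (θ : ℝ) (hθ : ∀ k : ℤ, θ ≠ k * (π / 2))
    (Rx Ry Rz : Matrix.orthogonalGroup (Fin 3) ℝ)
    (hRx : (Rx : Matrix (Fin 3) (Fin 3) ℝ) =
      !![1, 0, 0; 0, cos θ, -sin θ; 0, sin θ, cos θ])
    (hRy : (Ry : Matrix (Fin 3) (Fin 3) ℝ) =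
      !![cos θ, 0, sin θ; 0, 1, 0; -sin θ, 0, cos θ])
    (hRz : (Rz : Matrix (Fin 3) (Fin 3) ℝ) =
      !![cos θ, -sin θ, 0; sin θ, cos θ, 0; 0, 0, 1]) :
    closure ((Subgroup.closure {Rx, Ry, Rz} : Subgroup (Matrix.orthogonalGroup (Fin 3) ℝ)) :
        Set (Matrix.orthogonalGroup (Fin 3) ℝ)) =
      {A : Matrix.orthogonalGroup (Fin 3) ℝ | (A : Matrix (Fin 3) (Fin 3) ℝ).det = 1} := by
  have hsin2 : sin (2 * θ) ≠ 0 := by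
    rw [Ne, sin_eq_zero_iff]
    rintro ⟨k, hk⟩
    exact hθ k (by linarith)
  have hsin : sin θ ≠ 0 := fun h => hsin2 (by rw [sin_two_mul, h]; ring)
  have hsc := sin_sq_add_cos_sq θ
  have hle : closure ((Subgroup.closure {Rx, Ry, Rz} :
        Subgroup (Matrix.orthogonalGroup (Fin 3) ℝ)) : Set (Matrix.orthogonalGroup (Fin 3) ℝ)) ⊆
      {A : Matrix.orthogonalGroup (Fin 3) ℝ | (A : Matrix (Fin 3) (Fin 3) ℝ).det = 1} := by
    refine closure_minimal ?_ (isClosed_eq continuous_subtype_val.matrix_det continuous_const)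
    let d : Matrix.orthogonalGroup (Fin 3) ℝ →* ℝ :=
      Matrix.detMonoidHom.comp (Matrix.orthogonalGroup (Fin 3) ℝ).subtype
    change _ ≤ d.ker
    rw [Subgroup.closure_le]
    intro A hA
    change (A : Matrix (Fin 3) (Fin 3) ℝ).det = 1
    rcases hA with rfl | rfl | rfl
    · rw [hRx, Matrix.det_fin_three]; simp; linarith
    · rw [hRy, Matrix.det_fin_three]; simp; linarith
    · rw [hRz, Matrix.det_fin_three]; simp; linarith
  refine hle.antisymm fun A hA => ?_
  let H := (Subgroup.closure {Rx, Ry, Rz}).topologicalClosure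
  have hgen : ∀ g ∈ ({Rx, Ry, Rz} : Set (Matrix.orthogonalGroup (Fin 3) ℝ)), g ∈ H :=
    fun g hg => Subgroup.le_topologicalClosure _ (Subgroup.subset_closure hg)
  have hclosed : IsClosed (H : Set (Matrix.orthogonalGroup (Fin 3) ℝ)) :=
    Subgroup.isClosed_topologicalClosure _
  obtain ⟨v, hv, hrot⟩ : ∃ (v : Fin 3 → ℝ) (hv : v ⬝ᵥ v = 1), ∀ t,
      (⟨axisRotation v t, axisRotation_mem_orthogonalGroup hv t⟩ :
        Matrix.orthogonalGroup (Fin 3) ℝ) ∈ H := by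
    obtain ⟨v, φ, hv, hφ⟩ := exists_axisRotation_eq_mul θ
    have htr : 1 + 2 * cos φ = cos θ ^ 2 + 2 * cos θ := by
      have h := congrArg Matrix.trace hφ
      have h1 : (axisRotation v φ).trace = 1 + 2 * cos φ := by
        simp only [dotProduct, Fin.sum_univ_three] at hv
        simp [axisRotation, crossMatrix, Matrix.trace_fin_three]
        linear_combination (2 * cos φ - 2) * hv
      rw [← h1, h]
      simp [Matrix.trace_fin_three]
      ring
    rcases irrational_or_irrational hsin2 htr with hirr | hirr
    · have he : (![0, 0, 1] : Fin 3 → ℝ) ⬝ᵥ ![0, 0, 1] = 1 := by simp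
      refine ⟨![0, 0, 1], he, axisRotation_mem_of_irrational hclosed he hirr ?_⟩
      convert hgen Rz (by simp)
      rw [hRz]
      ext i j
      fin_cases i <;> fin_cases j <;> simp [axisRotation, crossMatrix]
    · refine ⟨v, hv, axisRotation_mem_of_irrational hclosed hv hirr ?_⟩
      convert H.mul_mem (hgen Rx (by simp)) (hgen Ry (by simp))
      rw [hφ, Submonoid.coe_mul, hRx, hRy]
  refine mem_of_axisRotation_mem hclosed (fun g hg => hle hg) hv hrot (fun z hz => ?_) A hA
  by_contra hz0
  let Z : Submodule ℝ (Fin 3 → ℝ) :=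
    { carrier := {z | ∀ g ∈ H, ((g : Matrix (Fin 3) (Fin 3) ℝ) *ᵥ v) ⬝ᵥ z = 0}
      add_mem' := fun ha hb g hg => by rw [dotProduct_add, ha g hg, hb g hg, add_zero]
      zero_mem' := fun g _ => dotProduct_zero _
      smul_mem' := fun c a ha g hg => by rw [dotProduct_smul, ha g hg, smul_zero] }
  have hinv : ∀ h ∈ H, ∀ z ∈ Z, (h : Matrix (Fin 3) (Fin 3) ℝ) *ᵥ z ∈ Z := by
    intro h hh z hz g hg
    have := hz (h⁻¹ * g) (H.mul_mem (H.inv_mem hh) hg)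
    rwa [Submonoid.coe_mul, coe_inv_eq_transpose, ← mulVec_mulVec, mulVec_transpose,
      ← dotProduct_mulVec] at this
  have htop : Z = ⊤ := by
    refine eq_top_of_mem_of_invariant hsin Z hRx hRy hRz ?_ (z := z) hz hz0
    rintro A (rfl | rfl | rfl) z hz <;>
      exact ⟨hinv _ (hgen _ (by simp)) z hz, hinv _ (H.inv_mem (hgen _ (by simp))) z hz⟩
  have hvZ : v ∈ Z := htop ▸ Submodule.mem_top
  have h1 := hvZ 1 H.one_mem
  rw [Submonoid.coe_one, one_mulVec, hv] at h1
  exact one_ne_zero h1
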